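/- Let m ≥ 1 and T ≥ 1 be integers, let L > 0, σ > 0, ζ ≥ 0, δ ∈ (0,1) be reals, and let p : ℕ → ℝ be a sequence with δ ≤ p(t) ≤ 1 for all t. Let r, f, Ξ : ℕ → ℝ be sequences with r(t) ≥ 0, f(t) ≥ 0, Ξ(t) ≥ 0 for all t, and with r₀ := r(0) > 0. Define η := min{ √(m·r₀/(σ²·T)), δ/(900·L), ( r₀/(T·L·(Π₁(T)·σ² + ζ²·Π₂(T))) )^{1/3} }. Assume that for every t ≥ 0, r(t+1) ≤ r(t) − η·f(t) + σ²·η²/m + 3·η·L·Ξ(t), and that for every t ≥ 1, Ξ(t) ≤ (1 − p(t−1)/2)·Ξ(t−1) + η²·( 72·L·f(t−1)/p(t−1) + 8σ² + 18ζ²/p(t−1) ). Then (1/T)·∑_{t=0}^{T−1} f(t) ≤ 4·√(σ²·r₀/(m·T)) + 6·L·(1 + π₀)·Ξ(0)/T + 1800·r₀·L/(T·δ) + 220·( r₀^{2/3}/T^{2/3} )·( L·(Π₁(T)·σ² + Π₂(T)·ζ²) )^{1/3}. -/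

import Mathlib

/-- `piSeq p j = ∑_{i > j} ∏_{t=j+1}^{i-1} (1 - p t / 2)`. -/
noncomputable def piSeq (p : ℕ → ℝ) (j : ℕ) : ℝ :=
  ∑' k : ℕ, ∏ t ∈ Finset.Ico (j + 1) (j + 1 + k), (1 - p t / 2)

/-- `Π₁(T) = (1/T) ∑_{j=0}^{T-1} π_j`. -/
noncomputable def Pi1 (p : ℕ → ℝ) (T : ℕ) : ℝ :=
  (1 / (T : ℝ)) * ∑ j ∈ Finset.range T, piSeq p j

/-- `Π₂(T) = (1/T) ∑_{j=0}^{T-1} π_j / p j`. -/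
noncomputable def Pi2 (p : ℕ → ℝ) (T : ℕ) : ℝ :=
  (1 / (T : ℝ)) * ∑ j ∈ Finset.range T, piSeq p j / p j

section ConsensusWeights

variable {p : ℕ → ℝ} {δ : ℝ}

lemma prod_one_sub_half_nonneg (hp1 : ∀ t, p t ≤ 1) (s : Finset ℕ) :
    0 ≤ ∏ t ∈ s, (1 - p t / 2) :=
  Finset.prod_nonneg fun t _ => by linarith [hp1 t]

lemma prod_one_sub_half_le_pow (hδ : ∀ t, δ ≤ p t) (hp1 : ∀ t, p t ≤ 1) (j k : ℕ) :
    ∏ t ∈ Finset.Ico j (j + k), (1 - p t / 2) ≤ (1 - δ / 2) ^ k := by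
  calc ∏ t ∈ Finset.Ico j (j + k), (1 - p t / 2)
      ≤ ∏ _t ∈ Finset.Ico j (j + k), (1 - δ / 2) :=
        Finset.prod_le_prod (fun t _ => by linarith [hp1 t]) fun t _ => by linarith [hδ t]
    _ = (1 - δ / 2) ^ k := by simp

lemma hasSum_one_sub_half_pow (hδ0 : 0 < δ) (hδ1 : δ ≤ 1) :
    HasSum (fun k : ℕ => (1 - δ / 2) ^ k) (2 / δ) := by
  have h := hasSum_geometric_of_lt_one (r := 1 - δ / 2) (by linarith) (by linarith)
  rwa [sub_sub_cancel, inv_div] at h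

lemma summable_prod_one_sub_half (hδ0 : 0 < δ) (hδ : ∀ t, δ ≤ p t) (hp1 : ∀ t, p t ≤ 1)
    (j : ℕ) : Summable fun k : ℕ => ∏ t ∈ Finset.Ico j (j + k), (1 - p t / 2) :=
  Summable.of_nonneg_of_le (fun _ => prod_one_sub_half_nonneg hp1 _)
    (prod_one_sub_half_le_pow hδ hp1 j)
    (hasSum_one_sub_half_pow hδ0 ((hδ 0).trans (hp1 0))).summable

lemma piSeq_le (hδ0 : 0 < δ) (hδ : ∀ t, δ ≤ p t) (hp1 : ∀ t, p t ≤ 1) (j : ℕ) :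
    piSeq p j ≤ 2 / δ := by
  have hs := hasSum_one_sub_half_pow hδ0 ((hδ 0).trans (hp1 0))
  rw [← hs.tsum_eq]
  exact (summable_prod_one_sub_half hδ0 hδ hp1 _).tsum_le_tsum
    (prod_one_sub_half_le_pow hδ hp1 _) hs.summable

lemma piSeq_eq (hδ0 : 0 < δ) (hδ : ∀ t, δ ≤ p t) (hp1 : ∀ t, p t ≤ 1) (j : ℕ) :
    piSeq p j = 1 + (1 - p (j + 1) / 2) * piSeq p (j + 1) := by
  unfold piSeq
  rw [(summable_prod_one_sub_half hδ0 hδ hp1 (j + 1)).tsum_eq_zero_add, ← tsum_mul_left]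
  congr 1
  · simp
  · congr 1 with k
    rw [Finset.prod_eq_prod_Ico_succ_bot (by omega)]
    congr 3
    omega

lemma piSeq_nonneg (hp1 : ∀ t, p t ≤ 1) (j : ℕ) : 0 ≤ piSeq p j :=
  tsum_nonneg fun _ => prod_one_sub_half_nonneg hp1 _

lemma piSeq_pos (hδ0 : 0 < δ) (hδ : ∀ t, δ ≤ p t) (hp1 : ∀ t, p t ≤ 1) (j : ℕ) :
    0 < piSeq p j := by
  rw [piSeq_eq hδ0 hδ hp1 j]
  have := mul_nonneg (by linarith [hp1 (j + 1)] : 0 ≤ 1 - p (j + 1) / 2)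
    (piSeq_nonneg hp1 (j + 1))
  linarith

lemma piSeq_div_le (hδ0 : 0 < δ) (hδ : ∀ t, δ ≤ p t) (hp1 : ∀ t, p t ≤ 1) (j : ℕ) :
    piSeq p j / p j ≤ 2 / δ ^ 2 := by
  calc piSeq p j / p j ≤ (2 / δ) / δ :=
        div_le_div₀ (by positivity) (piSeq_le hδ0 hδ hp1 j) hδ0 (hδ j)
    _ = 2 / δ ^ 2 := by rw [div_div, sq]

/-- Summing a contractive recursion weights the perturbation at time `j` by `π_j`. -/
lemma sum_le_of_contraction (hδ0 : 0 < δ) (hδ : ∀ t, δ ≤ p t) (hp1 : ∀ t, p t ≤ 1)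
    {Ξ g : ℕ → ℝ} (hΞ : ∀ t, 0 ≤ Ξ t) (h : ∀ t, Ξ (t + 1) ≤ (1 - p t / 2) * Ξ t + g t) (n : ℕ) :
    ∑ t ∈ Finset.range n, Ξ t ≤
      (1 + piSeq p 0) * Ξ 0 + ∑ t ∈ Finset.range n, piSeq p t * g t := by
  have key : ∀ n, ∑ t ∈ Finset.range n, Ξ t + (1 + (1 - p n / 2) * piSeq p n) * Ξ n ≤
      (1 + (1 - p 0 / 2) * piSeq p 0) * Ξ 0 + ∑ t ∈ Finset.range n, piSeq p t * g t := by
    intro n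
    induction n with
    | zero => simp
    | succ n ih =>
      rw [Finset.sum_range_succ, Finset.sum_range_succ, ← piSeq_eq hδ0 hδ hp1 n]
      have := mul_le_mul_of_nonneg_left (h n) (piSeq_nonneg hp1 n)
      linarith
  have hn : 0 ≤ (1 + (1 - p n / 2) * piSeq p n) * Ξ n := by
    have h₁ : 0 ≤ 1 - p n / 2 := by linarith [hp1 n]
    have h₂ := piSeq_nonneg hp1 n
    have h₃ := hΞ n
    positivity
  have h0 : 0 ≤ p 0 * (piSeq p 0 * Ξ 0) :=
    mul_nonneg (hδ0.le.trans (hδ 0)) (mul_nonneg (piSeq_nonneg hp1 0) (hΞ 0))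
  linarith [key n]

lemma Pi1_pos (hδ0 : 0 < δ) (hδ : ∀ t, δ ≤ p t) (hp1 : ∀ t, p t ≤ 1) {T : ℕ} (hT : 1 ≤ T) :
    0 < Pi1 p T := by
  have hT0 : (0 : ℝ) < T := by exact_mod_cast hT
  exact mul_pos (by positivity) (Finset.sum_pos (fun j _ => piSeq_pos hδ0 hδ hp1 j)
    (Finset.nonempty_range_iff.2 (by omega)))

lemma Pi2_nonneg (hδ0 : 0 < δ) (hδ : ∀ t, δ ≤ p t) (hp1 : ∀ t, p t ≤ 1) (T : ℕ) :
    0 ≤ Pi2 p T :=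
  mul_nonneg (by positivity) (Finset.sum_nonneg fun j _ =>
    div_nonneg (piSeq_nonneg hp1 j) (hδ0.le.trans (hδ j)))

/-- The bound on the total consensus error, with the gradient part kept separate. -/
lemma sum_consensus_le (hδ0 : 0 < δ) (hδ : ∀ t, δ ≤ p t) (hp1 : ∀ t, p t ≤ 1)
    {L σ ζ η : ℝ} (hL : 0 ≤ L) {f Ξ : ℕ → ℝ} (hf : ∀ t, 0 ≤ f t) (hΞ : ∀ t, 0 ≤ Ξ t)
    (h : ∀ t, Ξ (t + 1) ≤ (1 - p t / 2) * Ξ t +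
      η ^ 2 * (72 * L * f t / p t + 8 * σ ^ 2 + 18 * ζ ^ 2 / p t)) {T : ℕ} (hT : 1 ≤ T) :
    ∑ t ∈ Finset.range T, Ξ t ≤ (1 + piSeq p 0) * Ξ 0 +
      η ^ 2 * (144 * L / δ ^ 2 * ∑ t ∈ Finset.range T, f t +
        T * (18 * (Pi1 p T * σ ^ 2 + Pi2 p T * ζ ^ 2))) := by
  have hT0 : (T : ℝ) ≠ 0 := by exact_mod_cast (by omega : T ≠ 0)
  have h1 : (T : ℝ) * Pi1 p T = ∑ j ∈ Finset.range T, piSeq p j := by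
    unfold Pi1; field_simp
  have h2 : (T : ℝ) * Pi2 p T = ∑ j ∈ Finset.range T, piSeq p j / p j := by
    unfold Pi2; rw [← mul_assoc, mul_one_div_cancel hT0, one_mul]
  refine (sum_le_of_contraction hδ0 hδ hp1 hΞ h T).trans (add_le_add le_rfl ?_)
  calc ∑ t ∈ Finset.range T,
        piSeq p t * (η ^ 2 * (72 * L * f t / p t + 8 * σ ^ 2 + 18 * ζ ^ 2 / p t))
      ≤ ∑ t ∈ Finset.range T, η ^ 2 * (144 * L / δ ^ 2 * f t +
          (18 * σ ^ 2 * piSeq p t + 18 * ζ ^ 2 * (piSeq p t / p t))) := by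
        refine Finset.sum_le_sum fun t _ => ?_
        have hd := mul_le_mul_of_nonneg_left (piSeq_div_le hδ0 hδ hp1 t)
          (by have := hf t; positivity : 0 ≤ 72 * L * f t)
        have hs := mul_nonneg (sq_nonneg σ) (piSeq_nonneg hp1 t)
        calc piSeq p t * (η ^ 2 * (72 * L * f t / p t + 8 * σ ^ 2 + 18 * ζ ^ 2 / p t))
            = η ^ 2 * (72 * L * f t * (piSeq p t / p t) +
              (8 * σ ^ 2 * piSeq p t + 18 * ζ ^ 2 * (piSeq p t / p t))) := by ring
          _ ≤ _ := by
            refine mul_le_mul_of_nonneg_left ?_ (sq_nonneg η)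
            have : 144 * L / δ ^ 2 * f t = 72 * L * f t * (2 / δ ^ 2) := by ring
            linarith
    _ = _ := by
        rw [← Finset.mul_sum, Finset.sum_add_distrib, Finset.sum_add_distrib, ← Finset.mul_sum,
          ← Finset.mul_sum, ← Finset.mul_sum, ← h1, ← h2]
        ring

end ConsensusWeights

lemma add_sum_le_of_descent {r a b : ℕ → ℝ} (h : ∀ t, r (t + 1) ≤ r t - a t + b t) (n : ℕ) :
    r n + ∑ t ∈ Finset.range n, a t ≤ r 0 + ∑ t ∈ Finset.range n, b t := by
  induction n with
  | zero => simp
  | succ n ih =>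
    rw [Finset.sum_range_succ, Finset.sum_range_succ]
    linarith [h n]

lemma inv_min_le_add {x y : ℝ} (hx : 0 < x) (hy : 0 < y) : (min x y)⁻¹ ≤ x⁻¹ + y⁻¹ := by
  have hx' := inv_pos.2 hx
  have hy' := inv_pos.2 hy
  rcases min_choice x y with h | h <;> rw [h] <;> linarith

/-- The balance between the three regimes of the step size. -/
lemma stepsize_tradeoff {M T R L σ δ B η : ℝ} (hM : 0 < M) (hT : 0 < T) (hR : 0 < R)
    (hL : 0 < L) (hσ : 0 < σ) (hδ : 0 < δ) (hB : 0 < B)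
    (hη : η = min √(M * R / (σ ^ 2 * T))
      (min (δ / (900 * L)) ((R / (T * B)) ^ ((1 : ℝ) / 3)))) :
    2 * R / (T * η) + 2 * σ ^ 2 * η / M + 108 * B * η ^ 2 ≤
      4 * √(σ ^ 2 * R / (M * T)) + 1800 * R * L / (T * δ) +
        110 * (R ^ ((2 : ℝ) / 3) / T ^ ((2 : ℝ) / 3)) * B ^ ((1 : ℝ) / 3) := by
  set a := √(M * R / (σ ^ 2 * T)) with ha
  set c := (R / (T * B)) ^ ((1 : ℝ) / 3) with hc
  set s := √(σ ^ 2 * R / (M * T)) with hs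
  have ha0 : 0 < a := Real.sqrt_pos.2 (by positivity)
  have hc0 : 0 < c := by positivity
  have hb0 : 0 < δ / (900 * L) := by positivity
  have hη0 : 0 < η := hη ▸ lt_min ha0 (lt_min hb0 hc0)
  have hηa : η ≤ a := hη ▸ min_le_left _ _
  have hηc : η ≤ c := hη ▸ (min_le_right _ _).trans (min_le_right _ _)
  have hasq : a ^ 2 = M * R / (σ ^ 2 * T) := Real.sq_sqrt (by positivity)
  have has : σ ^ 2 * a / M = s := by
    have hsq : σ ^ 2 * R / (M * T) = (σ ^ 2 * a / M) ^ 2 := by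
      rw [div_pow, mul_pow, hasq]
      field_simp
    rw [hs, hsq, Real.sqrt_sq (by positivity)]
  have hRs : R / (T * a) = s := by
    rw [← has, div_eq_div_iff (by positivity) (by positivity)]
    calc R * M = T * σ ^ 2 * (M * R / (σ ^ 2 * T)) := by field_simp
      _ = σ ^ 2 * a * (T * a) := by rw [← hasq]; ring
  have hc3 : c ^ 3 = R / (T * B) := by
    rw [hc, ← Real.rpow_natCast, ← Real.rpow_mul (by positivity)]
    norm_num
  have hRc : R / (T * c) = B * c ^ 2 := by
    rw [div_eq_iff (by positivity)]
    calc R = B * T * (R / (T * B)) := by field_simp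
      _ = B * c ^ 2 * (T * c) := by rw [← hc3]; ring
  have hw : R ^ ((2 : ℝ) / 3) / T ^ ((2 : ℝ) / 3) * B ^ ((1 : ℝ) / 3) = B * c ^ 2 := by
    have hc2 : c ^ 2 = (R / (T * B)) ^ ((2 : ℝ) / 3) := by
      rw [hc, ← Real.rpow_natCast, ← Real.rpow_mul (by positivity)]
      norm_num
    have hBB : B = B ^ ((1 : ℝ) / 3) * B ^ ((2 : ℝ) / 3) := by
      rw [← Real.rpow_add hB]; norm_num
    rw [hc2, Real.div_rpow hR.le (by positivity), Real.mul_rpow hT.le hB.le]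
    nth_rw 2 [hBB]
    field_simp
  have hinv : η⁻¹ ≤ a⁻¹ + ((δ / (900 * L))⁻¹ + c⁻¹) := by
    rw [hη]
    exact (inv_min_le_add ha0 (lt_min hb0 hc0)).trans
      (add_le_add le_rfl (inv_min_le_add hb0 hc0))
  have h1 : 2 * R / (T * η) ≤ 2 * s + 1800 * R * L / (T * δ) + 2 * (B * c ^ 2) := by
    calc 2 * R / (T * η) = 2 * R / T * η⁻¹ := by field_simp
      _ ≤ 2 * R / T * (a⁻¹ + ((δ / (900 * L))⁻¹ + c⁻¹)) := by gcongr
      _ = 2 * (R / (T * a)) + 1800 * R * L / (T * δ) + 2 * (R / (T * c)) := by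
        field_simp
        ring
      _ = _ := by rw [hRs, hRc]
  have h2 : 2 * σ ^ 2 * η / M ≤ 2 * s := by
    calc 2 * σ ^ 2 * η / M ≤ 2 * σ ^ 2 * a / M := by gcongr
      _ = 2 * s := by rw [← has]; ring
  have h3 : 108 * B * η ^ 2 ≤ 108 * (B * c ^ 2) := by
    rw [← mul_assoc]; gcongr
  rw [mul_assoc 110, hw]
  linarith

theorem stmt15 (m T : ℕ) (hm : 1 ≤ m) (hT : 1 ≤ T)
    (L σ ζ δ : ℝ) (hL : 0 < L) (hσ : 0 < σ) (hζ : 0 ≤ ζ) (hδ0 : 0 < δ) (hδ1 : δ < 1)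
    (p : ℕ → ℝ) (hp : ∀ t : ℕ, δ ≤ p t ∧ p t ≤ 1)
    (r f Ξ : ℕ → ℝ) (hr : ∀ t, 0 ≤ r t) (hf : ∀ t, 0 ≤ f t) (hΞ : ∀ t, 0 ≤ Ξ t)
    (hr₀ : 0 < r 0)
    (η : ℝ)
    (hη : η = min (Real.sqrt ((m : ℝ) * r 0 / (σ ^ 2 * T)))
      (min (δ / (900 * L))
        ((r 0 / ((T : ℝ) * L * (Pi1 p T * σ ^ 2 + ζ ^ 2 * Pi2 p T))) ^ ((1 : ℝ) / 3))))
    (hdescent : ∀ t : ℕ,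
      r (t + 1) ≤ r t - η * f t + σ ^ 2 * η ^ 2 / m + 3 * η * L * Ξ t)
    (hconsensus : ∀ t : ℕ, 1 ≤ t →
      Ξ t ≤ (1 - p (t - 1) / 2) * Ξ (t - 1) +
        η ^ 2 * (72 * L * f (t - 1) / p (t - 1) + 8 * σ ^ 2 + 18 * ζ ^ 2 / p (t - 1))) :
    1 / (T : ℝ) * ∑ t ∈ Finset.range T, f t ≤
      4 * Real.sqrt (σ ^ 2 * r 0 / (m * T)) +
        6 * L * (1 + piSeq p 0) * Ξ 0 / T +
        1800 * r 0 * L / (T * δ) +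
        220 * (r 0 ^ ((2 : ℝ) / 3) / (T : ℝ) ^ ((2 : ℝ) / 3)) *
          (L * (Pi1 p T * σ ^ 2 + Pi2 p T * ζ ^ 2)) ^ ((1 : ℝ) / 3) := by
  have hδp : ∀ t, δ ≤ p t := fun t => (hp t).1
  have hp1 : ∀ t, p t ≤ 1 := fun t => (hp t).2
  have hm0 : (0 : ℝ) < m := by exact_mod_cast hm
  have hT0 : (0 : ℝ) < T := by exact_mod_cast hT
  have hPi1 := Pi1_pos hδ0 hδp hp1 hT
  have hPi2 := Pi2_nonneg hδ0 hδp hp1 T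
  set B := L * (Pi1 p T * σ ^ 2 + Pi2 p T * ζ ^ 2) with hB
  have hB0 : 0 < B := by positivity
  have hηB : η = min √((m : ℝ) * r 0 / (σ ^ 2 * T))
      (min (δ / (900 * L)) ((r 0 / (T * B)) ^ ((1 : ℝ) / 3))) := by
    rw [hη, hB, mul_assoc (T : ℝ) L, mul_comm (ζ ^ 2)]
  have hη0 : 0 < η := by
    rw [hηB]
    exact lt_min (Real.sqrt_pos.2 (by positivity)) (lt_min (by positivity) (by positivity))
  have hηδ : η * L / δ ≤ 1 / 900 := by
    have : η ≤ δ / (900 * L) := hη ▸ (min_le_right _ _).trans (min_le_left _ _)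
    rw [le_div_iff₀ (by positivity)] at this
    rw [div_le_iff₀ hδ0]
    linarith
  have hstep := stepsize_tradeoff hm0 hT0 hr₀ hL hσ hδ0 hB0 hηB
  have hcons := sum_consensus_le hδ0 hδp hp1 hL.le hf hΞ
    (fun t => by simpa using hconsensus (t + 1) (by omega)) hT
  have hdesc := add_sum_le_of_descent (r := r) (a := fun t => η * f t)
    (b := fun t => σ ^ 2 * η ^ 2 / m + 3 * η * L * Ξ t)
    (fun t => by linarith [hdescent t]) T
  rw [← Finset.mul_sum, Finset.sum_add_distrib, ← Finset.mul_sum, Finset.sum_const,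
    Finset.card_range, nsmul_eq_mul] at hdesc
  set F := ∑ t ∈ Finset.range T, f t
  have hF : 0 ≤ F := Finset.sum_nonneg fun t _ => hf t
  have habsorb : 3 * η * L * (η ^ 2 * (144 * L / δ ^ 2 * F)) ≤ η * F / 2 := by
    have hsq : (η * L / δ) ^ 2 ≤ (1 / 900) ^ 2 := by gcongr
    calc 3 * η * L * (η ^ 2 * (144 * L / δ ^ 2 * F)) = 432 * (η * L / δ) ^ 2 * (η * F) := by
          field_simp; ring
      _ ≤ 432 * (1 / 900) ^ 2 * (η * F) := by gcongr
      _ ≤ η * F / 2 := by linarith [mul_nonneg hη0.le hF]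
  have hcons' := mul_le_mul_of_nonneg_left hcons (by positivity : 0 ≤ 3 * η * L)
  have hhalf : η * F / 2 ≤ r 0 + T * (σ ^ 2 * η ^ 2 / m) +
      3 * η * L * ((1 + piSeq p 0) * Ξ 0) + 54 * η ^ 3 * T * B := by
    have hexp : 3 * η * L * ((1 + piSeq p 0) * Ξ 0 + η ^ 2 * (144 * L / δ ^ 2 * F +
        T * (18 * (Pi1 p T * σ ^ 2 + Pi2 p T * ζ ^ 2)))) =
        3 * η * L * ((1 + piSeq p 0) * Ξ 0) + 3 * η * L * (η ^ 2 * (144 * L / δ ^ 2 * F)) +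
          54 * η ^ 3 * T * B := by
      rw [hB]; ring
    linarith [hr T]
  have havg : 1 / (T : ℝ) * F ≤ 2 * r 0 / (T * η) + 2 * σ ^ 2 * η / m + 108 * B * η ^ 2 +
      6 * L * (1 + piSeq p 0) * Ξ 0 / T := by
    calc 1 / (T : ℝ) * F = 2 / (T * η) * (η * F / 2) := by field_simp
      _ ≤ 2 / (T * η) * _ := mul_le_mul_of_nonneg_left hhalf (by positivity)
      _ = _ := by field_simp; ring
  have hw : 0 ≤ r 0 ^ ((2 : ℝ) / 3) / (T : ℝ) ^ ((2 : ℝ) / 3) * B ^ ((1 : ℝ) / 3) := by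
    positivity
  linarith
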